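/- Define L : ℕ → ℝ by L(0) = 1/2 and L(n+1) = (2^n − 1)/2^{n+1} for every natural number n. Then (i) 0 ≤ L(n) < 1 for all n, (ii) L is injective, and (iii) the antidiagonal real number ∑_{n=0}^∞ (1 − d_{n+1}(L(n)))·2^{−(n+1)} is equal to L(0); in particular the antidiagonal real produced by the diagonal method applied to the list L belongs to the range of L. -/

import Mathlib

/-- The `k`-th canonical binary digit of a real `x`: `⌊x·2^k⌋ mod 2`. -/
noncomputable def binDigit (k : ℕ) (x : ℝ) : ℤ := ⌊x * 2 ^ k⌋ % 2

/-- The list `L(0) = 1/2`, `L(n+1) = (2^n − 1)/2^(n+1)`. -/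
noncomputable def L : ℕ → ℝ
  | 0 => 1 / 2
  | n + 1 => (2 ^ n - 1) / 2 ^ (n + 1)

theorem L_succ_eq (n : ℕ) : L (n + 1) = 1 / 2 - (1 / 2 : ℝ) ^ (n + 1) := by
  simp only [L]
  rw [one_div_pow, pow_succ]
  field_simp

theorem digit_zero : binDigit (0 + 1) (L 0) = 1 := by
  simp [binDigit, L]

theorem digit_succ (n : ℕ) : binDigit (n + 1 + 1) (L (n + 1)) = 0 := by
  have h : L (n + 1) * 2 ^ (n + 1 + 1) = ((2 * (2 ^ n - 1) : ℤ) : ℝ) := by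
    simp only [L]
    push_cast
    field_simp
    ring
  rw [binDigit, h, Int.floor_intCast]
  simp

theorem antidiag_hasSum :
    HasSum (fun n : ℕ => (1 - (binDigit (n + 1) (L n) : ℝ)) / 2 ^ (n + 1)) (1 / 2) := by
  rw [← hasSum_nat_add_iff' 1]
  have h := (hasSum_geometric_two).mul_left (1 / 4 : ℝ)
  convert h using 1
  · rfl
  · funext n
    rw [digit_succ, one_div_pow]
    field_simp
    push_cast
    ring
  · rw [Finset.sum_range_one, digit_zero]
    norm_num

theorem stmt_0 :
    (∀ n : ℕ, 0 ≤ L n ∧ L n < 1) ∧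
    Function.Injective L ∧
    (∑' n : ℕ, (1 - (binDigit (n + 1) (L n) : ℝ)) / 2 ^ (n + 1)) = L 0 ∧
    (∑' n : ℕ, (1 - (binDigit (n + 1) (L n) : ℝ)) / 2 ^ (n + 1)) ∈ Set.range L := by
  have hs := antidiag_hasSum.tsum_eq
  have h0 : L 0 = 1 / 2 := by simp only [L]
  refine ⟨?_, ?_, by rw [hs, h0], ⟨0, by rw [hs, h0]⟩⟩
  · rintro (_ | n)
    · rw [h0]; norm_num
    · rw [L_succ_eq]
      have h1 : (1 / 2 : ℝ) ^ n ≤ 1 := pow_le_one₀ (by norm_num) (by norm_num)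
      have h2 : (0 : ℝ) < (1 / 2 : ℝ) ^ n := by positivity
      rw [pow_succ]
      constructor <;> linarith
  · rintro (_ | m) (_ | n) h
    · rfl
    · rw [h0, L_succ_eq] at h
      have h2 : (0 : ℝ) < (1 / 2 : ℝ) ^ (n + 1) := by positivity
      linarith
    · rw [h0, L_succ_eq] at h
      have h2 : (0 : ℝ) < (1 / 2 : ℝ) ^ (m + 1) := by positivity
      linarith
    · rw [L_succ_eq, L_succ_eq] at h
      have h3 : (1 / 2 : ℝ) ^ (m + 1) = (1 / 2 : ℝ) ^ (n + 1) := by linarith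
      exact pow_right_injective₀ (by norm_num) (by norm_num) h3
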